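/- Let Λ > 0, μ = √(Λ/3). Suppose K : (0,∞) → ℝ is differentiable with K(t) ≥ √(3Λ) and K'(t) ≤ Λ − K(t)²/3 for all t > 0, and suppose y : (0,∞) → ℝ satisfies (1/2)·y(t)² ≤ K(t)²/3 − Λ for all t > 0. Then y(t)² ≤ 2Λ / sinh²(μ t) for all t > 0; in particular the kinetic energy of the scalar field decays exponentially fast toward zero. -/

import Mathlib

open Real Set in
/-- An upper bound for solutions of the Riccati inequality `K' ≤ 3μ² − K²/3` on `(0,∞)`:
a solution with `K ≥ 3μ` lies below `3μ coth (μ t)`. -/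
theorem mul_sinh_le_of_riccati {μ : ℝ} (hμ : 0 < μ) {K K' : ℝ → ℝ}
    (hder : ∀ t > (0 : ℝ), HasDerivAt K (K' t) t)
    (hlow : ∀ t > (0 : ℝ), 3 * μ ≤ K t)
    (hray : ∀ t > (0 : ℝ), K' t ≤ 3 * μ ^ 2 - K t ^ 2 / 3) {t : ℝ} (ht : 0 < t) :
    K t * sinh (μ * t) ≤ 3 * μ * cosh (μ * t) := by
  have hpos : ∀ s > (0 : ℝ), 0 < K s + 3 * μ := fun s hs => by linarith [hlow s hs]
  set G : ℝ → ℝ := fun s => (K s - 3 * μ) / (K s + 3 * μ) * exp (2 * μ * s) with hG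
  have hGder : ∀ s > (0 : ℝ), HasDerivAt G
      (6 * μ * exp (2 * μ * s) / (K s + 3 * μ) ^ 2 * (K' s - (3 * μ ^ 2 - K s ^ 2 / 3))) s := by
    intro s hs
    have hne := (hpos s hs).ne'
    have h := (((hder s hs).sub_const (3 * μ)).div ((hder s hs).add_const (3 * μ)) hne).mul
      (((hasDerivAt_id s).const_mul (2 * μ)).exp)
    refine h.congr_deriv ?_
    simp only [id, Pi.div_apply]
    field_simp
    ring
  have hanti : AntitoneOn G (Ioi 0) := by
    refine antitoneOn_of_deriv_nonpos (convex_Ioi 0)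
      (fun s hs => (hGder s hs).continuousAt.continuousWithinAt) ?_ ?_
    · rw [interior_Ioi]
      exact fun s hs => (hGder s hs).differentiableAt.differentiableWithinAt
    · rw [interior_Ioi]
      intro s hs
      rw [(hGder s hs).deriv]
      exact mul_nonpos_of_nonneg_of_nonpos (by positivity) (by linarith [hray s hs])
  have hGle : G t ≤ 1 := by
    have hlim : Filter.Tendsto (fun s => exp (2 * μ * s)) (nhdsWithin 0 (Ioi 0)) (nhds 1) := by
      have : Continuous fun s : ℝ => exp (2 * μ * s) := by fun_prop
      simpa using (this.tendsto 0).mono_left nhdsWithin_le_nhds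
    refine ge_of_tendsto hlim ?_
    filter_upwards [Ioo_mem_nhdsGT ht] with s hs
    refine (hanti hs.1 ht hs.2.le).trans ?_
    have : (K s - 3 * μ) / (K s + 3 * μ) ≤ 1 := by
      rw [div_le_one (hpos s hs.1)]
      linarith
    exact mul_le_of_le_one_left (exp_pos _).le this
  have hexp : exp (2 * μ * t) = exp (μ * t) * exp (μ * t) := by
    rw [← exp_add]
    ring_nf
  have hmul : (K t - 3 * μ) * (exp (μ * t) * exp (μ * t)) ≤ K t + 3 * μ := by
    simp only [hG, hexp] at hGle
    rwa [div_mul_eq_mul_div, div_le_one (hpos t ht)] at hGle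
  have hinv : exp (μ * t) * exp (-(μ * t)) = 1 := by
    rw [← exp_add]
    simp
  have hmul' := mul_le_mul_of_nonneg_right hmul (exp_pos (-(μ * t))).le
  have heq : (K t - 3 * μ) * (exp (μ * t) * exp (μ * t)) * exp (-(μ * t))
      = (K t - 3 * μ) * exp (μ * t) := by
    linear_combination (K t - 3 * μ) * exp (μ * t) * hinv
  rw [sinh_eq, cosh_eq]
  linarith

/-- Kinetic-energy decay in Wald's no-hair argument: if the expansion `K` satisfies
`K ≥ √(3Λ)` and `K' ≤ Λ − K²/3` on `(0,∞)`, and `y = φ̇` satisfies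
`(1/2) y² ≤ K²/3 − Λ`, then `y(t)² ≤ 2Λ / sinh²(μ t)` with `μ = √(Λ/3)`. -/
theorem wald_kinetic_bound (Λ : ℝ) (hΛ : 0 < Λ) (μ : ℝ)
    (hμ : μ = Real.sqrt (Λ / 3)) (K K' y : ℝ → ℝ)
    (hder : ∀ t > (0 : ℝ), HasDerivAt K (K' t) t)
    (hlow : ∀ t > (0 : ℝ), Real.sqrt (3 * Λ) ≤ K t)
    (hray : ∀ t > (0 : ℝ), K' t ≤ Λ - K t ^ 2 / 3)
    (hy : ∀ t > (0 : ℝ), (1 / 2) * y t ^ 2 ≤ K t ^ 2 / 3 - Λ) :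
    ∀ t > (0 : ℝ), y t ^ 2 ≤ 2 * Λ / Real.sinh (μ * t) ^ 2 := by
  have hμpos : 0 < μ := hμ ▸ Real.sqrt_pos.2 (by positivity)
  have hμsq : μ ^ 2 = Λ / 3 := by
    rw [hμ, Real.sq_sqrt (by positivity)]
  have hsqrt : Real.sqrt (3 * Λ) = 3 * μ := by
    rw [show 3 * Λ = (3 * μ) ^ 2 by linarith, Real.sqrt_sq (by positivity)]
  intro t ht
  have hsinh : 0 < Real.sinh (μ * t) := Real.sinh_pos_iff.2 (by positivity)
  have hK : 3 * μ ≤ K t := hsqrt ▸ hlow t ht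
  have hle := mul_sinh_le_of_riccati hμpos hder (fun s hs => hsqrt ▸ hlow s hs)
    (fun s hs => by linarith [hray s hs]) ht
  have hsq := pow_le_pow_left₀ (mul_nonneg (by linarith) hsinh.le) hle 2
  rw [mul_pow, mul_pow, Real.cosh_sq, mul_pow, hμsq] at hsq
  rw [le_div_iff₀ (by positivity)]
  have := mul_le_mul_of_nonneg_right (hy t ht) (sq_nonneg (Real.sinh (μ * t)))
  linarith
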